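/- arXiv:2003.00335 — 2 statements merged into one kernel-verified Lean document; each statement's English description precedes it below -/
import Mathlib

section
/- For all real x ≥ 1 and y > 1, one has (arcosh x)² ≤ (arcosh y)² + (2·arcosh(y)/√(y² − 1))·(x − y). -/
/-- The inverse hyperbolic cosine, `arcosh x = log (x + √(x² − 1))` for `x ≥ 1`. -/
noncomputable def arcosh (x : ℝ) : ℝ := Real.log (x + Real.sqrt (x ^ 2 - 1))

theorem convexOn_sinh_Ici : ConvexOn ℝ (Set.Ici 0) Real.sinh := by
  refine MonotoneOn.convexOn_of_deriv (convex_Ici 0) Real.continuous_sinh.continuousOn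
    Real.differentiable_sinh.differentiableOn ?_
  rw [Real.deriv_sinh, interior_Ici]
  exact Real.cosh_strictMonoOn.monotoneOn.mono Set.Ioi_subset_Ici_self

theorem mul_sinh_le_mul_sinh {s t : ℝ} (hs : 0 ≤ s) (hst : s ≤ t) :
    t * Real.sinh s ≤ s * Real.sinh t := by
  rcases hs.eq_or_lt with rfl | hs'
  · simp
  have ht : 0 < t := hs'.trans_le hst
  have h := convexOn_sinh_Ici.2 Set.self_mem_Ici ht.le
    (sub_nonneg.2 ((div_le_one ht).2 hst)) (div_nonneg hs ht.le) (sub_add_cancel 1 (s / t))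
  simp only [smul_eq_mul, mul_zero, zero_add, Real.sinh_zero, div_mul_cancel₀ s ht.ne'] at h
  calc t * Real.sinh s ≤ t * (s / t * Real.sinh t) := mul_le_mul_of_nonneg_left h ht.le
    _ = s * Real.sinh t := by field_simp

theorem sq_sub_sq_mul_sinh_le {s t : ℝ} (hs : 0 ≤ s) (ht : 0 ≤ t) :
    (s ^ 2 - t ^ 2) * Real.sinh t ≤ 2 * t * (Real.cosh s - Real.cosh t) := by
  let g : ℝ → ℝ := fun u => 2 * t * Real.cosh u - u ^ 2 * Real.sinh t
  have hg (u : ℝ) : HasDerivAt g (2 * (t * Real.sinh u - u * Real.sinh t)) u := by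
    refine HasDerivAt.congr_deriv (((Real.hasDerivAt_cosh u).const_mul (2 * t)).sub
      ((hasDerivAt_pow 2 u).mul_const (Real.sinh t))) ?_
    push_cast
    ring
  have hc : Continuous g := by fun_prop
  suffices h : g t ≤ g s by
    simp only [g] at h
    linarith
  rcases le_total s t with hst | hts
  · refine antitoneOn_of_hasDerivWithinAt_nonpos (convex_Icc 0 t) hc.continuousOn
      (fun u _ => (hg u).hasDerivWithinAt) (fun u hu => ?_) ⟨hs, hst⟩ ⟨ht, le_rfl⟩ hst
    have hu' := interior_subset hu
    linarith [mul_sinh_le_mul_sinh hu'.1 hu'.2]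
  · refine monotoneOn_of_hasDerivWithinAt_nonneg (convex_Ici t) hc.continuousOn
      (fun u _ => (hg u).hasDerivWithinAt) (fun u hu => ?_) Set.self_mem_Ici hts hts
    have hu' : t ≤ u := interior_subset hu
    linarith [mul_sinh_le_mul_sinh ht hu']

/-- the tangent-line upper bound for the concave function `x ↦ (arcosh x)²`:
for `x ≥ 1` and `y > 1`,
`(arcosh x)² ≤ (arcosh y)² + (2 arcosh y / √(y² − 1)) (x − y)`. -/
theorem arcosh_sq_le_tangent_line (x y : ℝ) (hx : 1 ≤ x) (hy : 1 < y) :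
    (arcosh x) ^ 2 ≤
      (arcosh y) ^ 2 + (2 * arcosh y / Real.sqrt (y ^ 2 - 1)) * (x - y) := by
  change Real.arcosh x ^ 2 ≤
    Real.arcosh y ^ 2 + (2 * Real.arcosh y / Real.sqrt (y ^ 2 - 1)) * (x - y)
  have hpos : 0 < Real.sqrt (y ^ 2 - 1) := Real.sqrt_pos.2 (by nlinarith)
  have h := sq_sub_sq_mul_sinh_le (Real.arcosh_nonneg hx) (Real.arcosh_nonneg hy.le)
  rw [Real.sinh_arcosh hy.le, Real.cosh_arcosh hx, Real.cosh_arcosh hy.le,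
    ← le_div_iff₀ hpos, mul_div_right_comm] at h
  linarith
end

section
/- Let K < 0, let x⁽¹⁾, …, x⁽ᵗ⁾ ∈ ℝ^{n+1} lie on the positive sheet of the hyperboloid of curvature K, and let w₁, …, w_t > 0. Define f(y) = Σ_{l=1}^t (w_l/|K|)·arcosh(K·⟨x⁽ˡ⁾, y⟩_L)² on the positive sheet. For y on the positive sheet, define the one-step update u = Σ_{l=1}^t w_l·φ(−|K|·⟨x⁽ˡ⁾, y⟩_L)·x⁽ˡ⁾ and y⁺ = u / √(−|K|·⟨u, u⟩_L), where φ(v) = 2·arcosh(v)/√(v² − 1) for v > 1 and φ(1) = 2. Then f(y⁺) ≤ f(y), and if y is not a minimizer of f over the positive sheet then f(y⁺) < f(y). -/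
/-- The Lorentzian inner product on `ℝ^{n+1}` (coordinates indexed `0, 1, …, n`):
`⟨x, y⟩_L = −x₀y₀ + ∑_{i=1}^n xᵢyᵢ`. -/
def lorentzInner {n : ℕ} (x y : Fin (n + 1) → ℝ) : ℝ :=
  -(x 0 * y 0) + ∑ i : Fin n, x i.succ * y i.succ

/-- The continuous extension of `v ↦ 2 arcosh v / √(v² − 1)` to `v = 1`
(its value for `v ≤ 1` is irrelevant; it is only used for `v ≥ 1`). -/
noncomputable def phiH (v : ℝ) : ℝ :=
  if v ≤ 1 then 2 else 2 * arcosh v / Real.sqrt (v ^ 2 - 1)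

section Scalar

open Real

theorem mul_sinh_le_mul_sinh_s11 {a b : ℝ} (ha : 0 ≤ a) (hab : a ≤ b) :
    b * sinh a ≤ a * sinh b := by
  rcases ha.eq_or_lt with rfl | ha
  · simp
  have hb : 0 < b := ha.trans_le hab
  have hconv : ConvexOn ℝ (Set.Ici 0) sinh := by
    refine convexOn_of_deriv2_nonneg' (convex_Ici 0) differentiable_sinh.differentiableOn ?_ ?_
    · simpa using differentiable_cosh.differentiableOn
    · intro x hx
      simpa using hx
  have h := hconv.2 (Set.mem_Ici.2 hb.le) (Set.mem_Ici.2 le_rfl) (show 0 ≤ a / b by positivity)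
    (show 0 ≤ 1 - a / b by rw [sub_nonneg, div_le_one hb]; exact hab) (by ring)
  simp only [smul_eq_mul, mul_zero, add_zero, sinh_zero, div_mul_cancel₀ a hb.ne'] at h
  calc b * sinh a ≤ b * (a / b * sinh b) := by gcongr
    _ = a * sinh b := by field_simp

theorem sq_sub_sq_mul_sinh_le_s11 {a c : ℝ} (ha : 0 ≤ a) (hc : 0 ≤ c) :
    (c ^ 2 - a ^ 2) * sinh a ≤ 2 * a * (cosh c - cosh a) := by
  set h : ℝ → ℝ := fun s => 2 * a * cosh s - s ^ 2 * sinh a with hh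
  have hd : ∀ s, HasDerivAt h (2 * a * sinh s - 2 * s * sinh a) s := fun s => by
    have : HasDerivAt h _ s := ((hasDerivAt_cosh s).const_mul (2 * a)).sub
      (((hasDerivAt_id s).pow 2).mul_const (sinh a))
    exact this.congr_deriv (by simp)
  have hcont : Continuous h := continuous_iff_continuousAt.2 fun s => (hd s).continuousAt
  suffices h a ≤ h c by simp only [hh] at this; linarith
  rcases lt_trichotomy a c with hac | rfl | hac
  · obtain ⟨s, ⟨hs1, hs2⟩, hs⟩ := exists_hasDerivAt_eq_slope h _ hac hcont.continuousOn
      fun s _ => hd s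
    have h1 := mul_sinh_le_mul_sinh_s11 ha hs1.le
    rw [eq_div_iff (sub_pos.2 hac).ne'] at hs
    nlinarith
  · exact le_rfl
  · obtain ⟨s, ⟨hs1, hs2⟩, hs⟩ := exists_hasDerivAt_eq_slope h _ hac hcont.continuousOn
      fun s _ => hd s
    have h1 := mul_sinh_le_mul_sinh_s11 (hc.trans hs1.le) hs2.le
    rw [eq_div_iff (sub_pos.2 hac).ne'] at hs
    nlinarith

theorem arcosh_eq_real_arcosh : _root_.arcosh = Real.arcosh := rfl

theorem phiH_mul_sinh_arcosh {a : ℝ} (ha : 1 ≤ a) :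
    phiH a * sinh (Real.arcosh a) = 2 * Real.arcosh a := by
  rcases ha.eq_or_lt with rfl | ha
  · simp
  · have : 0 < √(a ^ 2 - 1) := sqrt_pos.2 (by nlinarith)
    rw [sinh_arcosh ha.le, phiH, if_neg ha.not_ge, div_mul_cancel₀ _ this.ne',
      arcosh_eq_real_arcosh]

theorem phiH_pos (a : ℝ) : 0 < phiH a := by
  unfold phiH
  split_ifs with h
  · norm_num
  · have h := not_le.1 h
    have h1 := Real.arcosh_pos h
    have h2 : 0 < √(a ^ 2 - 1) := sqrt_pos.2 (by nlinarith)
    rw [arcosh_eq_real_arcosh]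
    positivity

/-- The concave function `arcosh²` lies below its tangents. -/
theorem arcosh_sq_le_add_phiH_mul {a c : ℝ} (ha : 1 ≤ a) (hc : 1 ≤ c) :
    Real.arcosh c ^ 2 ≤ Real.arcosh a ^ 2 + phiH a * (c - a) := by
  rcases ha.eq_or_lt with rfl | ha
  · have h := self_le_sinh_iff.2 (div_nonneg (arcosh_nonneg hc) zero_le_two)
    have h2 := cosh_sq (Real.arcosh c / 2)
    have h3 := cosh_two_mul (Real.arcosh c / 2)
    rw [mul_div_cancel₀ _ two_ne_zero, cosh_arcosh hc] at h3
    have h4 := div_nonneg (arcosh_nonneg hc) zero_le_two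
    simp only [phiH, le_refl, if_true, arcosh_zero]
    nlinarith
  · have h := sq_sub_sq_mul_sinh_le_s11 (arcosh_nonneg ha.le) (arcosh_nonneg hc)
    rw [cosh_arcosh ha.le, cosh_arcosh hc, ← phiH_mul_sinh_arcosh ha.le] at h
    have hs : 0 < sinh (Real.arcosh a) := sinh_pos_iff.2 (arcosh_pos ha)
    have : (Real.arcosh c ^ 2 - Real.arcosh a ^ 2) ≤ phiH a * (c - a) :=
      le_of_mul_le_mul_right (by linarith) hs
    linarith

/-- A weak form of the hyperbolic law of cosines comparison. -/
theorem cosh_sub_mul_le {p : ℝ} (hp : |p| ≤ 1) (a b : ℝ) :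
    cosh (a - p * b) ≤ cosh a * cosh b - p * (sinh a * sinh b) := by
  have h1 := exp_mul_le_cosh_add_mul_sinh hp b
  have h2 := exp_mul_le_cosh_add_mul_sinh (t := -p) (by rwa [abs_neg]) b
  have e1 : exp (a - p * b) = exp a * exp (-p * b) := by rw [← exp_add]; ring_nf
  have e2 : exp (-(a - p * b)) = exp (-a) * exp (p * b) := by rw [← exp_add]; ring_nf
  rw [cosh_eq (a - p * b), e1, e2, cosh_eq a, sinh_eq a]
  have h3 := mul_le_mul_of_nonneg_left h1 (exp_pos (-a)).le
  have h4 := mul_le_mul_of_nonneg_left h2 (exp_pos a).le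
  linarith

/-- Geodesic convexity of the squared hyperbolic distance, in terms of the hyperbolic cosines
of the side lengths of a triangle. -/
theorem arcosh_sq_sub_le {a b c : ℝ} (ha : 1 ≤ a) (hb : 1 ≤ b) (hc : 1 ≤ c)
    (h : (a * b - c) ^ 2 ≤ (a ^ 2 - 1) * (b ^ 2 - 1)) :
    Real.arcosh a ^ 2 - phiH a * (Real.arcosh b / sinh (Real.arcosh b)) * (a * b - c) ≤
      Real.arcosh c ^ 2 := by
  set A := Real.arcosh a
  set B := Real.arcosh b
  set C := Real.arcosh c
  have hA : 0 ≤ A := arcosh_nonneg ha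
  have hB : 0 ≤ B := arcosh_nonneg hb
  have hC : 0 ≤ C := arcosh_nonneg hc
  have ca : cosh A = a := cosh_arcosh ha
  have cb : cosh B = b := cosh_arcosh hb
  have cc : cosh C = c := cosh_arcosh hc
  have hsa : a ^ 2 - 1 = sinh A ^ 2 := by rw [← ca, cosh_sq]; ring
  have hsb : b ^ 2 - 1 = sinh B ^ 2 := by rw [← cb, cosh_sq]; ring
  rw [hsa, hsb, ← mul_pow, sq_le_sq] at h
  obtain ⟨p, hp, hpe⟩ : ∃ p : ℝ, |p| ≤ 1 ∧ a * b - c = p * (sinh A * sinh B) := by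
    by_cases h0 : sinh A * sinh B = 0
    · rw [h0, abs_zero, abs_nonpos_iff] at h
      exact ⟨0, by simp, by simp [h]⟩
    · refine ⟨(a * b - c) / (sinh A * sinh B), ?_, (div_mul_cancel₀ _ h0).symm⟩
      rw [abs_div]
      exact div_le_one_of_le₀ h (abs_nonneg _)
  have h1 := cosh_sub_mul_le hp A B
  rw [ca, cb, ← hpe, sub_sub_cancel, ← cc, cosh_le_cosh, ← sq_le_sq] at h1
  have hBs : B / sinh B * sinh B = B := by
    by_cases h0 : sinh B = 0
    · rw [sinh_eq_zero] at h0; simp [h0]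
    · field_simp
  have hAs : phiH a * sinh A = 2 * A := phiH_mul_sinh_arcosh ha
  have : phiH a * (B / sinh B) * (a * b - c) = 2 * A * B * p := by
    rw [hpe]
    calc _ = (phiH a * sinh A) * (B / sinh B * sinh B) * p := by ring
      _ = _ := by rw [hAs, hBs]
  rw [this]
  nlinarith [sq_nonneg (p * B)]

end Scalar

section Lorentz

variable {n : ℕ}

theorem lorentzInner_comm (x y : Fin (n + 1) → ℝ) : lorentzInner x y = lorentzInner y x := by
  simp only [lorentzInner, mul_comm]

theorem lorentzInner_add_left (x y z : Fin (n + 1) → ℝ) :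
    lorentzInner (x + y) z = lorentzInner x z + lorentzInner y z := by
  simp only [lorentzInner, Pi.add_apply, add_mul, Finset.sum_add_distrib]
  ring

theorem lorentzInner_smul_left (r : ℝ) (x z : Fin (n + 1) → ℝ) :
    lorentzInner (r • x) z = r * lorentzInner x z := by
  simp only [lorentzInner, Pi.smul_apply, smul_eq_mul, mul_assoc, mul_add, Finset.mul_sum]
  ring

theorem lorentzInner_add_right (x y z : Fin (n + 1) → ℝ) :
    lorentzInner z (x + y) = lorentzInner z x + lorentzInner z y := by
  simp only [lorentzInner_comm z, lorentzInner_add_left]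

theorem lorentzInner_smul_right (r : ℝ) (x z : Fin (n + 1) → ℝ) :
    lorentzInner z (r • x) = r * lorentzInner z x := by
  simp only [lorentzInner_comm z, lorentzInner_smul_left]

theorem lorentzInner_sum_smul_left {ι : Type*} (s : Finset ι) (m : ι → ℝ)
    (x : ι → Fin (n + 1) → ℝ) (z : Fin (n + 1) → ℝ) :
    lorentzInner (∑ i ∈ s, m i • x i) z = ∑ i ∈ s, m i * lorentzInner (x i) z := by
  classical
  induction s using Finset.induction_on with
  | empty => simp [lorentzInner]
  | insert i s hi ih =>
    rw [Finset.sum_insert hi, Finset.sum_insert hi, lorentzInner_add_left, ih,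
      lorentzInner_smul_left]

/-- The Lorentzian form is positive definite on the orthogonal complement of a timelike vector. -/
theorem lorentzInner_self_nonneg_of_orthogonal {v y : Fin (n + 1) → ℝ}
    (hy : lorentzInner y y < 0) (hvy : lorentzInner v y = 0) :
    0 ≤ lorentzInner v v ∧ (lorentzInner v v = 0 → v = 0) := by
  simp only [lorentzInner] at *
  have hcs := Finset.sum_mul_sq_le_sq_mul_sq Finset.univ (fun i : Fin n => v i.succ)
    (fun i : Fin n => y i.succ)
  simp only [← sq] at *
  have hY0 : 0 ≤ ∑ i : Fin n, y i.succ ^ 2 := Finset.sum_nonneg fun i _ => sq_nonneg _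
  have hV0 : 0 ≤ ∑ i : Fin n, v i.succ ^ 2 := Finset.sum_nonneg fun i _ => sq_nonneg _
  have hsum : ∑ i : Fin n, v i.succ * y i.succ = v 0 * y 0 := by linarith
  rw [hsum] at hcs
  set V := ∑ i : Fin n, v i.succ ^ 2 with hV
  set Y := ∑ i : Fin n, y i.succ ^ 2
  have hy0 : 0 < y 0 ^ 2 := by linarith
  refine ⟨?_, fun h => ?_⟩
  · by_contra! hlt
    nlinarith
  · have hv0 : v 0 = 0 := by
      by_contra hne
      have : 0 < v 0 ^ 2 := by positivity
      nlinarith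
    have hVz : V = 0 := by rw [hv0] at h; linarith
    rw [hV, Finset.sum_eq_zero_iff_of_nonneg fun i _ => sq_nonneg _] at hVz
    funext i
    refine Fin.cases hv0 (fun j => ?_) i
    simpa using hVz j (Finset.mem_univ j)

theorem lorentzInner_sq_le_of_orthogonal {v z y : Fin (n + 1) → ℝ}
    (hy : lorentzInner y y < 0) (hvy : lorentzInner v y = 0) (hzy : lorentzInner z y = 0) :
    lorentzInner v z ^ 2 ≤ lorentzInner v v * lorentzInner z z := by
  have h : ∀ s : ℝ, 0 ≤ lorentzInner z z * (s * s) + 2 * lorentzInner v z * s +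
      lorentzInner v v := fun s => by
    have h1 := (lorentzInner_self_nonneg_of_orthogonal (v := v + s • z) hy (by
      rw [lorentzInner_add_left, lorentzInner_smul_left, hvy, hzy]; ring)).1
    simp only [lorentzInner_add_left, lorentzInner_smul_left, lorentzInner_add_right,
      lorentzInner_smul_right, lorentzInner_comm z v] at h1
    linarith
  have := discrim_le_zero h
  rw [discrim] at this
  linarith

/-- Two future-directed timelike vectors have negative Lorentzian inner product. -/
theorem lorentzInner_neg_of_timelike {x y : Fin (n + 1) → ℝ}
    (hx : lorentzInner x x < 0) (hx0 : 0 < x 0) (hy : lorentzInner y y < 0) (hy0 : 0 < y 0) :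
    lorentzInner x y < 0 := by
  simp only [lorentzInner] at *
  have hcs := Finset.sum_mul_sq_le_sq_mul_sq Finset.univ (fun i : Fin n => x i.succ)
    (fun i : Fin n => y i.succ)
  simp only [← sq] at *
  have hY0 : 0 ≤ ∑ i : Fin n, y i.succ ^ 2 := Finset.sum_nonneg fun i _ => sq_nonneg _
  have hX0 : 0 ≤ ∑ i : Fin n, x i.succ ^ 2 := Finset.sum_nonneg fun i _ => sq_nonneg _
  have h1 : (∑ i : Fin n, x i.succ ^ 2) * (∑ i : Fin n, y i.succ ^ 2) < (x 0 * y 0) ^ 2 := by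
    rw [mul_pow]
    exact mul_lt_mul'' (by linarith) (by linarith) hX0 hY0
  have := lt_of_pow_lt_pow_left₀ 2 (by positivity) (hcs.trans_lt h1)
  linarith

variable {K : ℝ} {x y z : Fin (n + 1) → ℝ}

theorem lorentzInner_orthogonal_projection (hK : K < 0) (hy : lorentzInner y y = 1 / K) :
    lorentzInner (x + (-(K * lorentzInner x y)) • y) y = 0 := by
  rw [lorentzInner_add_left, lorentzInner_smul_left, hy]
  field_simp [hK.ne]
  ring

/-- The Gram determinant inequality for three points of the hyperboloid. -/
theorem gram_sq_le (hK : K < 0) (hx : lorentzInner x x = 1 / K) (hy : lorentzInner y y = 1 / K)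
    (hz : lorentzInner z z = 1 / K) :
    (K * lorentzInner x y * (K * lorentzInner y z) - K * lorentzInner x z) ^ 2 ≤
      ((K * lorentzInner x y) ^ 2 - 1) * ((K * lorentzInner y z) ^ 2 - 1) := by
  have hyneg : lorentzInner y y < 0 := by rw [hy]; exact one_div_neg.2 hK
  have h := lorentzInner_sq_le_of_orthogonal hyneg (lorentzInner_orthogonal_projection (x := x) hK hy)
    (lorentzInner_orthogonal_projection (x := z) hK hy)
  simp only [lorentzInner_add_left, lorentzInner_smul_left, lorentzInner_add_right,
    lorentzInner_smul_right, hx, hy, hz, lorentzInner_comm z y, lorentzInner_comm y x] at h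
  have h2 := mul_le_mul_of_nonneg_left h (sq_nonneg K)
  have hK' := hK.ne
  refine le_of_eq_of_le ?_ (h2.trans_eq ?_)
  · field_simp
    ring
  · field_simp
    ring

theorem one_le_mul_lorentzInner (hK : K < 0) (hx : lorentzInner x x = 1 / K ∧ 0 < x 0)
    (hy : lorentzInner y y = 1 / K ∧ 0 < y 0) :
    1 ≤ K * lorentzInner x y ∧ (K * lorentzInner x y = 1 → x = y) := by
  have hK1 : 1 / K < 0 := one_div_neg.2 hK
  have hxneg : lorentzInner x x < 0 := by rw [hx.1]; exact hK1
  have hyneg : lorentzInner y y < 0 := by rw [hy.1]; exact hK1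
  have hneg := lorentzInner_neg_of_timelike hxneg hx.2 hyneg hy.2
  have hpos : 0 < K * lorentzInner x y := mul_pos_of_neg_of_neg hK hneg
  obtain ⟨h1, h2⟩ := lorentzInner_self_nonneg_of_orthogonal hyneg
    (lorentzInner_orthogonal_projection (x := x) hK hy.1)
  have he : lorentzInner (x + (-(K * lorentzInner x y)) • y)
      (x + (-(K * lorentzInner x y)) • y) = (1 - (K * lorentzInner x y) ^ 2) / K := by
    have hK' := hK.ne
    simp only [lorentzInner_add_left, lorentzInner_smul_left, lorentzInner_add_right,
      lorentzInner_smul_right, hx.1, hy.1, lorentzInner_comm y x]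
    field_simp
    ring
  rw [he] at h1 h2
  constructor
  · by_contra! hlt
    exact absurd h1 (not_le.2 (div_neg_of_pos_of_neg (by nlinarith) hK))
  · intro h
    rw [h] at h2
    have := h2 (by norm_num)
    rwa [neg_one_smul, ← sub_eq_add_neg, sub_eq_zero] at this

end Lorentz

/-- descent property of one step of the hyperboloid-model Fréchet mean
algorithm: `f(y⁺) ≤ f(y)`, strictly if `y` is not a minimizer of `f` over the positive
sheet. -/
theorem hyperboloid_frechet_mean_step_descent
    (n t : ℕ) (ht : 0 < t) (K : ℝ) (hK : K < 0)
    (x : Fin t → Fin (n + 1) → ℝ)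
    (hxsheet : ∀ l, lorentzInner (x l) (x l) = 1 / K ∧ 0 < x l 0)
    (w : Fin t → ℝ) (hw : ∀ l, 0 < w l)
    (f : (Fin (n + 1) → ℝ) → ℝ)
    (hf : ∀ z, f z = ∑ l, (w l / |K|) * (arcosh (K * lorentzInner (x l) z)) ^ 2)
    (y : Fin (n + 1) → ℝ) (hy : lorentzInner y y = 1 / K ∧ 0 < y 0)
    (u : Fin (n + 1) → ℝ)
    (hu : u = ∑ l, (w l * phiH (-(|K| * lorentzInner (x l) y))) • x l)
    (yplus : Fin (n + 1) → ℝ)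
    (hyplus : yplus = (Real.sqrt (-(|K| * lorentzInner u u)))⁻¹ • u) :
    f yplus ≤ f y ∧
    ((¬ ∀ z : Fin (n + 1) → ℝ, lorentzInner z z = 1 / K → 0 < z 0 → f y ≤ f z) →
      f yplus < f y) := by
  have hK' := hK.ne
  have hK1 : 1 / K < 0 := one_div_neg.2 hK
  have hk : 0 < |K| := abs_pos.2 hK'
  have hkK : |K| = -K := abs_of_neg hK
  simp only [arcosh_eq_real_arcosh] at hf
  simp only [hkK, neg_mul, neg_neg] at hu hyplus
  set m : Fin t → ℝ := fun l => w l * phiH (K * lorentzInner (x l) y) with hm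
  have hmpos : ∀ l, 0 < m l := fun l => mul_pos (hw l) (phiH_pos _)
  have hu' : u = ∑ l, m l • x l := hu
  have huin : ∀ z, lorentzInner u z = ∑ l, m l * lorentzInner (x l) z := fun z => by
    rw [hu', lorentzInner_sum_smul_left]
  have hxneg : ∀ l, lorentzInner (x l) (x l) < 0 := fun l => by rw [(hxsheet l).1]; exact hK1
  have : Nonempty (Fin t) := ⟨⟨0, ht⟩⟩
  have huu : lorentzInner u u < 0 := by
    rw [huin]
    refine Finset.sum_neg (fun l _ => mul_neg_of_pos_of_neg (hmpos l) ?_) Finset.univ_nonempty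
    rw [lorentzInner_comm, huin]
    exact Finset.sum_neg (fun j _ => mul_neg_of_pos_of_neg (hmpos j)
      (lorentzInner_neg_of_timelike (hxneg j) (hxsheet j).2 (hxneg l) (hxsheet l).2))
      Finset.univ_nonempty
  have hu0 : 0 < u 0 := by
    rw [hu', Finset.sum_apply]
    exact Finset.sum_pos (fun l _ => mul_pos (hmpos l) (hxsheet l).2) Finset.univ_nonempty
  set r := √(K * lorentzInner u u) with hr
  have hrpos : 0 < r := Real.sqrt_pos.2 (mul_pos_of_neg_of_neg hK huu)
  have hr2 : r ^ 2 = K * lorentzInner u u := Real.sq_sqrt (mul_pos_of_neg_of_neg hK huu).le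
  have huy : u = r • yplus := by rw [hyplus, smul_inv_smul₀ hrpos.ne']
  have hyp : lorentzInner yplus yplus = 1 / K ∧ 0 < yplus 0 := by
    constructor
    · rw [hyplus, lorentzInner_smul_left, lorentzInner_smul_right]
      field_simp
      linarith
    · rw [hyplus]
      exact mul_pos (inv_pos.2 hrpos) hu0
  have hdist : ∀ l z, lorentzInner z z = 1 / K → 0 < z 0 → 1 ≤ K * lorentzInner (x l) z :=
    fun l z h1 h2 => (one_le_mul_lorentzInner hK (hxsheet l) ⟨h1, h2⟩).1
  obtain ⟨he1, he2⟩ := one_le_mul_lorentzInner hK hyp hy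
  -- the first-order upper bound coming from concavity
  have hupper : f yplus ≤ f y + r * (1 - K * lorentzInner yplus y) / |K| := by
    have : r * (1 - K * lorentzInner yplus y) / |K| = ∑ l, w l / |K| *
        (phiH (K * lorentzInner (x l) y) *
          (K * lorentzInner (x l) yplus - K * lorentzInner (x l) y)) := by
      have h1 : r * (1 - K * lorentzInner yplus y) =
          K * (lorentzInner u yplus - lorentzInner u y) := by
        rw [huy, lorentzInner_smul_left, lorentzInner_smul_left, hyp.1]
        field_simp
      rw [h1, huin, huin, ← Finset.sum_sub_distrib, Finset.mul_sum, Finset.sum_div]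
      refine Finset.sum_congr rfl fun l _ => ?_
      simp only [hm]
      ring
    rw [this, hf, hf, ← Finset.sum_add_distrib]
    refine Finset.sum_le_sum fun l _ => ?_
    rw [← mul_add]
    exact mul_le_mul_of_nonneg_left (arcosh_sq_le_add_phiH_mul (hdist l y hy.1 hy.2)
      (hdist l yplus hyp.1 hyp.2)) (div_pos (hw l) hk).le
  refine ⟨hupper.trans ?_, fun hmin => ?_⟩
  · have := div_nonneg (mul_nonneg hrpos.le (sub_nonneg.2 he1)) hk.le
    have e : r * (1 - K * lorentzInner yplus y) / |K| =
        -(r * (K * lorentzInner yplus y - 1) / |K|) := by ring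
    linarith
  rcases he1.eq_or_lt with he | he
  · -- a fixed point of the update is a critical point, hence a minimizer by convexity
    exfalso
    refine hmin fun z hz hz0 => ?_
    rw [he2 he.symm] at huy
    have hb := (one_le_mul_lorentzInner hK hy ⟨hz, hz0⟩).1
    set s := Real.arcosh (K * lorentzInner y z) / Real.sinh (Real.arcosh (K * lorentzInner y z))
    have hzero : ∑ l, w l / |K| * (phiH (K * lorentzInner (x l) y) * s *
        (K * lorentzInner (x l) y * (K * lorentzInner y z) - K * lorentzInner (x l) z)) = 0 := by
      have h1 : ∑ l, w l / |K| * (phiH (K * lorentzInner (x l) y) * s *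
          (K * lorentzInner (x l) y * (K * lorentzInner y z) - K * lorentzInner (x l) z)) =
          s * K / |K| * (lorentzInner u y * (K * lorentzInner y z) - lorentzInner u z) := by
        rw [huin, huin, Finset.sum_mul, ← Finset.sum_sub_distrib, Finset.mul_sum]
        refine Finset.sum_congr rfl fun l _ => ?_
        simp only [hm]
        ring
      rw [h1, huy, lorentzInner_smul_left, lorentzInner_smul_left, hy.1]
      field_simp
      ring
    rw [← sub_zero (f y), ← hzero, hf, hf, ← Finset.sum_sub_distrib]
    refine Finset.sum_le_sum fun l _ => ?_
    rw [← mul_sub]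
    exact mul_le_mul_of_nonneg_left (arcosh_sq_sub_le (hdist l y hy.1 hy.2) hb (hdist l z hz hz0)
      (gram_sq_le hK (hxsheet l).1 hy.1 hz)) (div_pos (hw l) hk).le
  · have := div_pos (mul_pos hrpos (sub_pos.2 he)) hk
    have e : r * (1 - K * lorentzInner yplus y) / |K| =
        -(r * (K * lorentzInner yplus y - 1) / |K|) := by ring
    linarith
end
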